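/- Approximation time for the (1+1) EA with the heavy-tailed operator: Fix ε > 0 and α ∈ (0,1). For every a ∈ ℤⁿ \ {0ⁿ}, the expected number of iterations until the (1+1) EA with the heavy-tailed step operator with parameter ε, started at the all-0 integer string, first reaches a search point x with f_a(x) ≤ |a|₁ · α is O(n · log(|a|₁) · log(1/α) · (log(log |a|₁))^{1+ε}). -/

import Mathlib

open scoped ENNReal BigOperators

/-- The fitness `f_a(x) = ∑ i, |x i − a i|` (to be minimized). -/
def fitness {n : ℕ} (a x : Fin n → ℤ) : ℕ := ∑ i, (x i - a i).natAbs

/-- `|a|₁ = ∑ i, |a i|`. -/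
def normOne {n : ℕ} (a : Fin n → ℤ) : ℕ := ∑ i, (a i).natAbs

/-- `|a|_∞ = max_i |a i|`. -/
def normInf {n : ℕ} (a : Fin n → ℤ) : ℕ := Finset.univ.sup fun i => (a i).natAbs

/-- `|a|_H = |{i : a i ≠ 0}|`. -/
def normH {n : ℕ} (a : Fin n → ℤ) : ℕ := (Finset.univ.filter fun i => a i ≠ 0).card

/-- Probability that mutating the single component value `xi` (which happens with
probability `1/n`, and otherwise the component is left unchanged) results in the value `z`;
here `stepP xi z` is the probability that the step operator applied to `xi` returns `z`. -/
noncomputable def coordMutP (n : ℕ) (stepP : ℤ → ℤ → ℝ≥0∞) (xi z : ℤ) : ℝ≥0∞ :=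
  (1 - 1 / (n : ℝ≥0∞)) * (if z = xi then 1 else 0) + (1 / (n : ℝ≥0∞)) * stepP xi z

/-- Probability that the mutation of `x` (each component independently being replaced, with
probability `1/n`, by the result of the step operator) produces the offspring `y`. -/
noncomputable def mutP (n : ℕ) (stepP : ℤ → ℤ → ℝ≥0∞) (x y : Fin n → ℤ) : ℝ≥0∞ :=
  ∏ i, coordMutP n stepP (x i) (y i)

/-- One-step transition probability of the (1+1) EA on `f_a` with the given step operator:
the offspring `y` is produced by mutation and accepted iff `f_a(y) ≤ f_a(x)`; otherwise
the parent `x` is kept. -/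
noncomputable def transP (n : ℕ) (a : Fin n → ℤ) (stepP : ℤ → ℤ → ℝ≥0∞)
    (x y : Fin n → ℤ) : ℝ≥0∞ :=
  (if fitness a y ≤ fitness a x then mutP n stepP x y else 0) +
    (if y = x then ∑' z : Fin n → ℤ,
      (if fitness a x < fitness a z then mutP n stepP x z else 0) else 0)

/-- Distribution of the search point of the (1+1) EA after `t` iterations, started at the
all-`0` integer string. -/
noncomputable def eaDist (n : ℕ) (a : Fin n → ℤ) (stepP : ℤ → ℤ → ℝ≥0∞) :
    ℕ → (Fin n → ℤ) → ℝ≥0∞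
  | 0 => fun x => if x = (fun _ => 0) then 1 else 0
  | t + 1 => fun y => ∑' x : Fin n → ℤ, eaDist n a stepP t x * transP n a stepP x y

/-- Expected optimization time of the (1+1) EA on `f_a` (started at the all-`0` string):
since the optimum is absorbing, `E[T] = ∑_{t ≥ 0} P(T > t) = ∑_{t ≥ 0} P(f_a(X_t) ≠ 0)`. -/
noncomputable def eaExpTime (n : ℕ) (a : Fin n → ℤ) (stepP : ℤ → ℤ → ℝ≥0∞) : ℝ≥0∞ :=
  ∑' t : ℕ, ∑' x : Fin n → ℤ, if fitness a x = 0 then 0 else eaDist n a stepP t x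

/-- The `±1` step operator: with probability `1/2` return `xi + 1`, otherwise `xi - 1`. -/
noncomputable def pmStepP (xi z : ℤ) : ℝ≥0∞ :=
  (if z = xi + 1 then 1 / 2 else 0) + (if z = xi - 1 then 1 / 2 else 0)

/-- `c_ε = ∑_{i ≥ 2} 1 / (i (log i)^{1+ε})`. -/
noncomputable def cEps (ε : ℝ) : ℝ :=
  ∑' i : ℕ, if 2 ≤ i then 1 / (i * Real.log i ^ (1 + ε)) else 0

/-- The heavy-tailed step operator with parameter `ε`: sample `I ≥ 2` with
`P(I = i) = 1 / (c_ε i (log i)^{1+ε})`, then return `xi + 2^{I-2}` with probability `1/2`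
and `xi − 2^{I-2}` otherwise. -/
noncomputable def htStepP (ε : ℝ) (xi z : ℤ) : ℝ≥0∞ :=
  ∑' i : ℕ, if 2 ≤ i ∧ (z = xi + 2 ^ (i - 2) ∨ z = xi - 2 ^ (i - 2)) then
    ENNReal.ofReal (1 / (2 * (cEps ε * i * Real.log i ^ (1 + ε)))) else 0

/-- Expected number of iterations of the (1+1) EA (started at the all-`0` string) until the
first search point `x` with `f_a(x) ≤ |a|₁ · α` is reached: since the fitness never
increases, the set of such search points is absorbing and
`E[T] = ∑_{t ≥ 0} P(f_a(X_t) > |a|₁ · α)`. -/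
noncomputable def eaExpApproxTime (n : ℕ) (a : Fin n → ℤ) (stepP : ℤ → ℤ → ℝ≥0∞)
    (α : ℝ) : ℝ≥0∞ :=
  ∑' t : ℕ, ∑' x : Fin n → ℤ,
    if (fitness a x : ℝ) ≤ (normOne a : ℝ) * α then 0 else eaDist n a stepP t x


lemma ht_summable (ε : ℝ) (hε : 0 < ε) :
    Summable (fun i : ℕ => if 2 ≤ i then 1 / ((i:ℝ) * Real.log i ^ (1 + ε)) else 0) := by
  have hl2 : 0 < Real.log 2 := Real.log_pos (by norm_num)
  let g : ℕ → ℝ := fun i => if 2 ≤ i then 1 / ((i:ℝ) * Real.log i ^ (1 + ε))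
    else 1 / (2 * Real.log 2 ^ (1 + ε))
  have hg : Summable g := by
    rw [← summable_condensed_iff_of_nonneg]
    · rw [← summable_nat_add_iff 1]
      have h := ((Real.summable_one_div_nat_rpow (p := 1 + ε)).2 (by linarith))
      rw [← summable_nat_add_iff 1] at h
      refine (h.mul_left (1 / Real.log 2 ^ (1 + ε))).congr ?_
      intro k
      have h2 : 2 ≤ 2 ^ (k + 1) := by
        rw [pow_succ]; have := Nat.one_le_two_pow (n := k); omega
      simp only [g, if_pos h2]
      push_cast
      rw [Real.log_pow, Real.mul_rpow (by positivity) hl2.le]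
      push_cast
      have h3 : 0 < Real.log 2 ^ (1 + ε) := Real.rpow_pos_of_pos hl2 _
      have h4 : 0 < ((k:ℝ) + 1) ^ (1 + ε) := Real.rpow_pos_of_pos (by positivity) _
      field_simp
    · intro i
      simp only [g]
      split_ifs with h
      · have : 0 ≤ Real.log i := Real.log_natCast_nonneg i
        positivity
      · positivity
    · intro m k hm hmk
      have key : ∀ u v : ℝ, 2 ≤ u → u ≤ v → 1 / (v * Real.log v ^ (1 + ε)) ≤
          1 / (u * Real.log u ^ (1 + ε)) := by
        intro u v hu huv
        have h1 : 0 < Real.log u := Real.log_pos (by linarith)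
        have h2 : Real.log u ≤ Real.log v := Real.log_le_log (by linarith) huv
        have h3 : 0 < Real.log u ^ (1 + ε) := Real.rpow_pos_of_pos h1 _
        have h4 : Real.log u ^ (1 + ε) ≤ Real.log v ^ (1 + ε) :=
          Real.rpow_le_rpow h1.le h2 (by linarith)
        have hu0 : 0 < u := by linarith
        apply one_div_le_one_div_of_le (by positivity)
        exact mul_le_mul huv h4 h3.le (by linarith)
      simp only [g]
      split_ifs with h1 h2 h2
      · exact key _ _ (by exact_mod_cast h2) (by exact_mod_cast hmk)
      · exact key _ _ le_rfl (by exact_mod_cast h1)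
      · omega
      · exact le_rfl
  rw [← summable_nat_add_iff 2] at hg ⊢
  refine hg.congr ?_
  intro i
  simp [g]

lemma ht_cEps_pos (ε : ℝ) (hε : 0 < ε) : 0 < cEps ε := by
  unfold cEps
  refine (ht_summable ε hε).tsum_pos ?_ 2 ?_
  · intro i
    split_ifs with h
    · have : 0 ≤ Real.log i := Real.log_natCast_nonneg i
      positivity
    · exact le_rfl
  · have hl2 : 0 < Real.log 2 := Real.log_pos (by norm_num)
    simp only [le_refl, if_true]
    push_cast
    positivity

lemma ht_step_sum (ε : ℝ) (hε : 0 < ε) (xi : ℤ) : ∑' z, htStepP ε xi z ≤ 1 := by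
  have hc := ht_cEps_pos ε hε
  unfold htStepP
  rw [ENNReal.tsum_comm]
  have h1 : ∀ i : ℕ, (∑' z : ℤ, if 2 ≤ i ∧ (z = xi + 2 ^ (i - 2) ∨ z = xi - 2 ^ (i - 2)) then
      ENNReal.ofReal (1 / (2 * (cEps ε * i * Real.log i ^ (1 + ε)))) else 0) ≤
      ENNReal.ofReal ((1 / cEps ε) * if 2 ≤ i then 1 / ((i:ℝ) * Real.log i ^ (1 + ε)) else 0) := by
    intro i
    by_cases hi : 2 ≤ i
    · have hlog : 0 ≤ Real.log i := Real.log_natCast_nonneg i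
      set p : ℝ := 1 / (2 * (cEps ε * i * Real.log i ^ (1 + ε))) with hp
      have hp0 : 0 ≤ p := by positivity
      calc (∑' z : ℤ, if 2 ≤ i ∧ (z = xi + 2 ^ (i - 2) ∨ z = xi - 2 ^ (i - 2)) then
            ENNReal.ofReal p else 0)
          ≤ ∑' z : ℤ, ((if z = xi + 2 ^ (i - 2) then ENNReal.ofReal p else 0) +
              (if z = xi - 2 ^ (i - 2) then ENNReal.ofReal p else 0)) := by
            apply ENNReal.tsum_le_tsum
            intro z
            split_ifs <;> simp_all
        _ = ENNReal.ofReal p + ENNReal.ofReal p := by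
            rw [ENNReal.tsum_add, tsum_ite_eq, tsum_ite_eq]
        _ = ENNReal.ofReal (p + p) := (ENNReal.ofReal_add hp0 hp0).symm
        _ ≤ _ := by
            apply ENNReal.ofReal_le_ofReal
            rw [if_pos hi, hp]
            apply le_of_eq
            have : 0 < Real.log i := Real.log_pos (by exact_mod_cast hi)
            have h3 : 0 < Real.log i ^ (1 + ε) := Real.rpow_pos_of_pos this _
            have : (0:ℝ) < i := by positivity
            field_simp
            norm_num
    · simp [hi]
  refine (ENNReal.tsum_le_tsum h1).trans ?_
  rw [← ENNReal.ofReal_tsum_of_nonneg, tsum_mul_left]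
  · change ENNReal.ofReal (1 / cEps ε * cEps ε) ≤ 1
    rw [one_div_mul_cancel hc.ne']; simp
  · intro i
    split_ifs with h
    · have : 0 ≤ Real.log i := Real.log_natCast_nonneg i
      positivity
    · simp
  · exact (ht_summable ε hε).mul_left _

lemma tsum_pi_prod : ∀ (n : ℕ) (g : Fin n → ℤ → ℝ≥0∞),
    ∑' y : Fin n → ℤ, ∏ i, g i (y i) = ∏ i, ∑' z, g i z := by
  intro n
  induction n with
  | zero => intro g; simp
  | succ n ih =>
    intro g
    rw [← (Fin.consEquiv (fun _ : Fin (n+1) => ℤ)).tsum_eq, ENNReal.tsum_prod']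
    simp only [Fin.consEquiv_apply, Fin.prod_univ_succ, Fin.cons_zero, Fin.cons_succ]
    simp_rw [ENNReal.tsum_mul_left]
    rw [ENNReal.tsum_mul_right, ih]

lemma inv_n_le (n : ℕ) (hn : 1 ≤ n) : (1 / (n : ℝ≥0∞)) ≤ 1 := by
  rw [one_div, ENNReal.inv_le_one]; exact_mod_cast hn

lemma mut_sum (n : ℕ) (hn : 1 ≤ n) (ε : ℝ) (hε : 0 < ε) (x : Fin n → ℤ) :
    ∑' y, mutP n (htStepP ε) x y ≤ 1 := by
  unfold mutP
  rw [tsum_pi_prod n (fun i z => coordMutP n (htStepP ε) (x i) z)]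
  apply Finset.prod_le_one'
  intro i _
  unfold coordMutP
  rw [ENNReal.tsum_add, ENNReal.tsum_mul_left, ENNReal.tsum_mul_left, tsum_ite_eq, mul_one]
  calc _ ≤ (1 - 1 / (n : ℝ≥0∞)) + (1 / (n : ℝ≥0∞)) * 1 := by
        gcongr; exact ht_step_sum ε hε _
    _ = 1 := by rw [mul_one, tsub_add_cancel_of_le (inv_n_le n hn)]

lemma pow_lower (n : ℕ) (hn : 1 ≤ n) :
    ENNReal.ofReal (Real.exp (-1)) ≤ (1 - 1 / (n : ℝ≥0∞)) ^ (n - 1) := by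
  obtain ⟨m, rfl⟩ : ∃ m, n = m + 1 := ⟨n - 1, by omega⟩
  have e : (1 - 1 / ((m + 1 : ℕ) : ℝ≥0∞)) = ENNReal.ofReal (1 - 1 / ((m:ℝ) + 1)) := by
    rw [ENNReal.ofReal_sub _ (by positivity), ENNReal.ofReal_div_of_pos (by positivity)]
    have : ENNReal.ofReal ((m:ℝ) + 1) = ((m + 1 : ℕ) : ℝ≥0∞) := by
      rw [← ENNReal.ofReal_natCast]; push_cast; rfl
    rw [this]; simp
  have h0 : (0:ℝ) ≤ 1 - 1 / ((m:ℝ) + 1) := by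
    rw [sub_nonneg, div_le_one (by positivity)]
    have : (0:ℝ) ≤ m := by positivity
    linarith
  rw [e, ← ENNReal.ofReal_pow h0]
  apply ENNReal.ofReal_le_ofReal
  simp only [Nat.add_sub_cancel]
  rcases Nat.eq_zero_or_pos m with rfl | hm
  · simp
  · have hm' : (0:ℝ) < m := by exact_mod_cast hm
    have h1 : 1 - 1 / ((m:ℝ) + 1) = (1 + 1 / (m:ℝ))⁻¹ := by field_simp; ring
    have h2 : 1 + 1 / (m:ℝ) ≤ Real.exp (1 / m) := by
      have := Real.add_one_le_exp (1 / (m:ℝ)); linarith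
    rw [h1, inv_pow, Real.exp_neg]
    apply inv_anti₀ (by positivity)
    calc (1 + 1 / (m:ℝ)) ^ m ≤ (Real.exp (1 / m)) ^ m := by gcongr
      _ = Real.exp 1 := by rw [← Real.exp_nat_mul]; congr 1; field_simp

lemma trans_support {n : ℕ} {a : Fin n → ℤ} {s} {x y : Fin n → ℤ} (h : transP n a s x y ≠ 0) :
    fitness a y ≤ fitness a x := by
  by_contra hlt
  apply h
  unfold transP
  rw [if_neg hlt, if_neg (by rintro rfl; exact hlt le_rfl), add_zero]

lemma dist_support {n : ℕ} {a : Fin n → ℤ} {s} (t : ℕ) :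
    ∀ x, eaDist n a s t x ≠ 0 → fitness a x ≤ normOne a := by
  induction t with
  | zero =>
    intro x hx
    simp only [eaDist, ne_eq, ite_eq_right_iff, not_forall] at hx
    obtain ⟨rfl, _⟩ := hx
    simp [fitness, normOne]
  | succ t ih =>
    intro y hy
    simp only [eaDist] at hy
    rw [Ne, ENNReal.tsum_eq_zero] at hy
    push Not at hy
    obtain ⟨x, hx⟩ := hy
    exact (trans_support (right_ne_zero_of_mul hx)).trans (ih x (left_ne_zero_of_mul hx))

/-- expected next fitness plus expected gain is at most the current fitness -/
lemma drift_gain (n : ℕ) (hn : 1 ≤ n) (ε : ℝ) (hε : 0 < ε) (a x : Fin n → ℤ) :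
    (∑' y, transP n a (htStepP ε) x y * (fitness a y : ℝ≥0∞)) +
      (∑' y, mutP n (htStepP ε) x y * ((fitness a x - fitness a y : ℕ) : ℝ≥0∞)) ≤
      fitness a x := by
  set m := mutP n (htStepP ε) x with hm
  have h1 : (∑' y, transP n a (htStepP ε) x y * (fitness a y : ℝ≥0∞)) =
      ∑' y, m y * ((min (fitness a y) (fitness a x) : ℕ) : ℝ≥0∞) := by
    unfold transP
    simp_rw [add_mul, ite_mul, zero_mul]
    rw [ENNReal.tsum_add, tsum_ite_eq x (fun y => (∑' z, if fitness a x < fitness a z then mutP n (htStepP ε) x z else 0) * (fitness a y : ℝ≥0∞)),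
      ← ENNReal.tsum_mul_right, ← ENNReal.tsum_add]
    congr 1
    ext y
    by_cases h : fitness a y ≤ fitness a x
    · rw [if_pos h, if_neg (by omega), min_eq_left h]; simp [hm]
    · rw [if_neg h, if_pos (by omega), min_eq_right (by omega)]; simp [hm]
  rw [h1, ← ENNReal.tsum_add]
  have h2 : ∀ y, m y * ((min (fitness a y) (fitness a x) : ℕ) : ℝ≥0∞) +
      m y * ((fitness a x - fitness a y : ℕ) : ℝ≥0∞) = m y * (fitness a x : ℝ≥0∞) := by
    intro y
    rw [← mul_add, ← Nat.cast_add]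
    congr 2
    omega
  simp_rw [h2]
  rw [ENNReal.tsum_mul_right]
  calc _ ≤ 1 * (fitness a x : ℝ≥0∞) := by gcongr; exact mut_sum n hn ε hε x
    _ = _ := one_mul _

lemma step_lower (ε : ℝ) (hε : 0 < ε) (L k : ℕ) (hk : k + 2 ≤ L) (xi z : ℤ)
    (hz : z = xi + 2 ^ k ∨ z = xi - 2 ^ k) :
    ENNReal.ofReal (1 / (2 * (cEps ε * L * Real.log L ^ (1 + ε)))) ≤ htStepP ε xi z := by
  have hc := ht_cEps_pos ε hε
  unfold htStepP
  refine le_trans ?_ (ENNReal.le_tsum (k + 2))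
  rw [if_pos ⟨by omega, by simpa using hz⟩]
  apply ENNReal.ofReal_le_ofReal
  have h1 : 0 < Real.log ((k + 2 : ℕ) : ℝ) := Real.log_pos (by
    push_cast
    have : (0:ℝ) ≤ k := by positivity
    linarith)
  have hkL : ((k + 2 : ℕ) : ℝ) ≤ L := by exact_mod_cast hk
  have hk0 : (0:ℝ) < ((k + 2 : ℕ) : ℝ) := by positivity
  have h2 := Real.log_le_log hk0 hkL
  have h4 := Real.rpow_le_rpow h1.le h2 (by linarith : 0 ≤ 1 + ε)
  have h3 := Real.rpow_pos_of_pos h1 (1 + ε)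
  apply one_div_le_one_div_of_le (by positivity)
  gcongr

lemma fitness_update {n : ℕ} (a x : Fin n → ℤ) (i : Fin n) (z : ℤ) :
    fitness a (Function.update x i z) + (x i - a i).natAbs =
      fitness a x + (z - a i).natAbs := by
  unfold fitness
  rw [← Finset.add_sum_erase _ _ (Finset.mem_univ i),
    ← Finset.add_sum_erase _ (fun j => (x j - a j).natAbs) (Finset.mem_univ i)]
  have : ∑ j ∈ Finset.univ.erase i, (Function.update x i z j - a j).natAbs =
      ∑ j ∈ Finset.univ.erase i, (x j - a j).natAbs := by
    apply Finset.sum_congr rfl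
    intro j hj
    rw [Function.update_of_ne (Finset.ne_of_mem_erase hj)]
  rw [this, Function.update_self]
  omega

lemma gain_lower (n : ℕ) (hn : 1 ≤ n) (ε : ℝ) (hε : 0 < ε) (a x : Fin n → ℤ)
    (hx : fitness a x ≤ normOne a) (L : ℕ) (hL : L = Nat.log 2 (normOne a) + 2) :
    (1 / (n : ℝ≥0∞)) * ENNReal.ofReal (1 / (2 * (cEps ε * L * Real.log L ^ (1 + ε)))) *
      ENNReal.ofReal (Real.exp (-1)) * (fitness a x : ℝ≥0∞) ≤
    2 * (∑' y, mutP n (htStepP ε) x y * ((fitness a x - fitness a y : ℕ) : ℝ≥0∞)) := by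
  set P := ENNReal.ofReal (1 / (2 * (cEps ε * L * Real.log L ^ (1 + ε)))) with hP
  set E := ENNReal.ofReal (Real.exp (-1)) with hE
  let d : Fin n → ℕ := fun i => (x i - a i).natAbs
  let k : Fin n → ℕ := fun i => Nat.log 2 (d i)
  let w : Fin n → ℤ := fun i => if a i < x i then x i - 2 ^ k i else x i + 2 ^ k i
  let Y : Fin n → (Fin n → ℤ) := fun i => Function.update x i (w i)
  have hwne : ∀ i, w i ≠ x i := by
    intro i
    have : (0:ℤ) < 2 ^ k i := by positivity
    simp only [w]; split_ifs <;> omega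
  have hYinj : Function.Injective Y := by
    intro i j hij
    by_contra hne
    have := congrFun hij i
    simp only [Y] at this
    rw [Function.update_self, Function.update_of_ne hne] at this
    exact hwne i this
  have hterm : ∀ i, (1 / (n : ℝ≥0∞)) * P * E * (d i : ℝ≥0∞) ≤
      2 * (mutP n (htStepP ε) x (Y i) * ((fitness a x - fitness a (Y i) : ℕ) : ℝ≥0∞)) := by
    intro i
    by_cases hd : d i = 0
    · simp [hd]
    have hdle : d i ≤ fitness a x := by
      unfold fitness
      exact Finset.single_le_sum (f := fun i => (x i - a i).natAbs) (fun _ _ => Nat.zero_le _) (Finset.mem_univ i)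
    have hkL : k i + 2 ≤ L := by
      rw [hL]
      have := Nat.log_mono_right (b := 2) (hdle.trans hx)
      simp only [k]; omega
    have hk1 : 2 ^ k i ≤ d i := Nat.pow_log_le_self 2 hd
    have hk2 : d i < 2 ^ k i * 2 := by
      have := Nat.lt_pow_succ_log_self (b := 2) (by norm_num) (d i)
      rwa [pow_succ] at this
    have hgain : d i ≤ 2 * (fitness a x - fitness a (Y i)) := by
      have h := fitness_update a x i (w i)
      have h' : (w i - a i).natAbs + 2 ^ k i = d i := by
        have c : ((2 ^ k i : ℕ) : ℤ) = 2 ^ k i := by push_cast; rfl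
        simp only [w, d] at *
        rw [← c]
        split_ifs <;> omega
      simp only [d, Y] at *
      omega
    have hmut : (1 / (n : ℝ≥0∞)) * P * E ≤ mutP n (htStepP ε) x (Y i) := by
      unfold mutP
      rw [← Finset.mul_prod_erase _ _ (Finset.mem_univ i)]
      apply mul_le_mul'
      · unfold coordMutP
        refine le_trans ?_ le_add_self
        gcongr
        apply step_lower ε hε L (k i) hkL
        simp only [Y, Function.update_self, w]
        split_ifs <;> simp
      · refine (pow_lower n hn).trans ?_
        have hcard : (Finset.univ.erase i).card = n - 1 := by
          rw [Finset.card_erase_of_mem (Finset.mem_univ i)]; simp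
        rw [← hcard, ← Finset.prod_const]
        apply Finset.prod_le_prod'
        intro j hj
        have hYj : Y i j = x j := Function.update_of_ne (Finset.ne_of_mem_erase hj) _ _
        unfold coordMutP
        rw [if_pos hYj, mul_one]
        exact le_self_add
    calc _ ≤ mutP n (htStepP ε) x (Y i) * ((2 * (fitness a x - fitness a (Y i)) : ℕ) : ℝ≥0∞) := by
          gcongr
      _ = _ := by push_cast; ring
  calc _ = ∑ i, (1 / (n : ℝ≥0∞)) * P * E * (d i : ℝ≥0∞) := by
        rw [← Finset.mul_sum]; congr 1; simp [fitness, d]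
    _ ≤ ∑ i, 2 * (mutP n (htStepP ε) x (Y i) * ((fitness a x - fitness a (Y i) : ℕ) : ℝ≥0∞)) :=
        Finset.sum_le_sum fun i _ => hterm i
    _ = 2 * ∑ i, (fun y => (mutP n (htStepP ε) x y * ((fitness a x - fitness a y : ℕ) : ℝ≥0∞))) (Y i) := by
        rw [Finset.mul_sum]
    _ ≤ _ := by
        gcongr
        rw [← tsum_fintype (L := .unconditional _)]
        exact ENNReal.tsum_comp_le_tsum_of_injective hYinj _

lemma time_bound (n : ℕ) (hn : 1 ≤ n) (ε : ℝ) (hε : 0 < ε) (α : ℝ)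
    (a : Fin n → ℤ) (L : ℕ) (hL : L = Nat.log 2 (normOne a) + 2) :
    (1 / (n : ℝ≥0∞)) * ENNReal.ofReal (1 / (2 * (cEps ε * L * Real.log L ^ (1 + ε)))) *
      ENNReal.ofReal (Real.exp (-1)) * ENNReal.ofReal (normOne a * α) *
      eaExpApproxTime n a (htStepP ε) α ≤ 2 * (normOne a : ℝ≥0∞) := by
  set Q := (1 / (n : ℝ≥0∞)) * ENNReal.ofReal (1 / (2 * (cEps ε * L * Real.log L ^ (1 + ε)))) *
      ENNReal.ofReal (Real.exp (-1)) with hQ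
  set K := Q * ENNReal.ofReal (normOne a * α) with hK
  let p : ℕ → ℝ≥0∞ := fun t => ∑' x : Fin n → ℤ,
    if (fitness a x : ℝ) ≤ (normOne a : ℝ) * α then 0 else eaDist n a (htStepP ε) t x
  let V : ℕ → ℝ≥0∞ := fun t => ∑' x : Fin n → ℤ, eaDist n a (htStepP ε) t x * (fitness a x : ℝ≥0∞)
  have hstep : ∀ t, 2 * V (t + 1) + K * p t ≤ 2 * V t := by
    intro t
    have hV : V (t + 1) = ∑' x, eaDist n a (htStepP ε) t x *
        ∑' y, transP n a (htStepP ε) x y * (fitness a y : ℝ≥0∞) := by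
      simp only [V, eaDist]
      simp_rw [← ENNReal.tsum_mul_right, ← ENNReal.tsum_mul_left]
      rw [ENNReal.tsum_comm]
      simp_rw [mul_assoc]
    rw [hV]
    simp only [V, p]
    rw [← ENNReal.tsum_mul_left, ← ENNReal.tsum_mul_left, ← ENNReal.tsum_mul_left, ← ENNReal.tsum_add]
    apply ENNReal.tsum_le_tsum
    intro x
    by_cases h0 : eaDist n a (htStepP ε) t x = 0
    · simp [h0]
    have hx := dist_support t x h0
    have h1 := drift_gain n hn ε hε a x
    have h2 := gain_lower n hn ε hε a x hx L hL
    set D := eaDist n a (htStepP ε) t x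
    set S := ∑' y, transP n a (htStepP ε) x y * (fitness a y : ℝ≥0∞)
    set G := ∑' y, mutP n (htStepP ε) x y * ((fitness a x - fitness a y : ℕ) : ℝ≥0∞)
    have h3 : K * (if (fitness a x : ℝ) ≤ (normOne a : ℝ) * α then 0 else D) ≤ D * (2 * G) := by
      split_ifs with hf
      · simp
      · rw [mul_comm]
        gcongr
        refine le_trans ?_ h2
        rw [hK]
        gcongr
        rw [← ENNReal.ofReal_natCast]
        exact ENNReal.ofReal_le_ofReal (by linarith)
    calc _ ≤ 2 * (D * S) + D * (2 * G) := by gcongr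
      _ = 2 * (D * (S + G)) := by ring
      _ ≤ _ := by gcongr
  have hV0 : V 0 = normOne a := by
    simp only [V, eaDist, ite_mul, one_mul, zero_mul]
    rw [tsum_ite_eq (fun _ => 0) (fun x => (fitness a x : ℝ≥0∞))]
    simp [fitness, normOne]
  have htel : ∀ T, 2 * V T + ∑ t ∈ Finset.range T, K * p t ≤ 2 * V 0 := by
    intro T
    induction T with
    | zero => simp
    | succ T ih =>
      rw [Finset.sum_range_succ]
      calc _ = (2 * V (T + 1) + K * p T) + ∑ t ∈ Finset.range T, K * p t := by ring
        _ ≤ 2 * V T + ∑ t ∈ Finset.range T, K * p t := by gcongr; exact hstep T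
        _ ≤ _ := ih
  change K * ∑' t, p t ≤ _
  rw [← ENNReal.tsum_mul_left, ← hV0]
  apply ENNReal.tsum_le_of_sum_range_le
  intro T
  exact le_add_self.trans (htel T)

lemma L_bound (ε : ℝ) (hε : 0 < ε) (M : ℕ) (hM : 81 ≤ M) (L : ℕ) (hL : L = Nat.log 2 M + 2) :
    (L : ℝ) * Real.log L ^ (1 + ε) ≤
      4 * 2 ^ (1 + ε) * (Real.log M * Real.log (Real.log M) ^ (1 + ε)) := by
  have hM0 : (81:ℝ) ≤ M := by exact_mod_cast hM
  have hlogM : 4 ≤ Real.log M := by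
    rw [Real.le_log_iff_exp_le (by linarith)]
    have : Real.exp 4 = Real.exp 1 ^ 4 := by rw [← Real.exp_nat_mul]; norm_num
    rw [this]
    have h3 : Real.exp 1 ≤ 3 := Real.exp_one_lt_three.le
    calc Real.exp 1 ^ 4 ≤ (3:ℝ) ^ 4 := by gcongr
      _ ≤ (M:ℝ) := by norm_num; exact hM
  have hl2 : (0.69:ℝ) < Real.log 2 := by have := Real.log_two_gt_d9; linarith
  have hL1 : (L : ℝ) ≤ 4 * Real.log M := by
    have h : (2:ℝ) ^ (Nat.log 2 M) ≤ M := by exact_mod_cast Nat.pow_log_le_self 2 (by omega)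
    have h' := Real.log_le_log (by positivity) h
    rw [Real.log_pow] at h'
    have hn : (0:ℝ) ≤ (Nat.log 2 M : ℝ) := by positivity
    rw [hL]; push_cast
    nlinarith
  have hL2 : (2:ℝ) ≤ L := by rw [hL]; push_cast; linarith [(by positivity : (0:ℝ) ≤ (Nat.log 2 M : ℝ))]
  have hloglog : Real.log 4 ≤ Real.log (Real.log M) := Real.log_le_log (by norm_num) hlogM
  have hlog4 : 0 < Real.log 4 := Real.log_pos (by norm_num)
  have hlogL : Real.log L ≤ 2 * Real.log (Real.log M) := by
    have := Real.log_le_log (by linarith) hL1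
    rw [Real.log_mul (by norm_num) (by linarith)] at this
    linarith
  have h0 : 0 ≤ Real.log L := Real.log_natCast_nonneg L
  have h := Real.rpow_le_rpow h0 hlogL (by linarith : 0 ≤ 1 + ε)
  rw [Real.mul_rpow (by norm_num) (by linarith)] at h
  calc _ ≤ (4 * Real.log M) * (2 ^ (1 + ε) * Real.log (Real.log M) ^ (1 + ε)) := by
        apply mul_le_mul hL1 h (by positivity) (by linarith)
    _ = _ := by ring

/-- **Approximation time for the (1+1) EA with the heavy-tailed operator.**
Fix `ε > 0` and `α ∈ (0,1)`.  For every `a ∈ ℤⁿ \ {0ⁿ}` (with `|a|₁` large enough, as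
expressed by the threshold `N` of the `O`-notation), the expected number of iterations until
the (1+1) EA with the heavy-tailed step operator with parameter `ε`, started at the all-`0`
integer string, first reaches a search point `x` with `f_a(x) ≤ |a|₁ · α` is
`O(n · log(|a|₁) · log(1/α) · (log log |a|₁)^{1+ε})`. -/
theorem ea_ht_approx_time (ε : ℝ) (hε : 0 < ε) (α : ℝ) (hα₀ : 0 < α) (hα₁ : α < 1) :
    ∃ C : ℝ, 0 < C ∧ ∃ N : ℕ, ∀ (n : ℕ) (a : Fin n → ℤ), a ≠ 0 → N ≤ normOne a →
      eaExpApproxTime n a (htStepP ε) α ≤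
        ENNReal.ofReal (C * n * Real.log (normOne a) * Real.log (1 / α) *
          Real.log (Real.log (normOne a)) ^ (1 + ε)) := by
  have hc := ht_cEps_pos ε hε
  have hlα : 0 < Real.log (1 / α) := Real.log_pos (by rw [lt_div_iff₀ hα₀]; linarith)
  refine ⟨16 * 2 ^ (1 + ε) * cEps ε * Real.exp 1 / (α * Real.log (1 / α)), by positivity, 81, ?_⟩
  intro n a ha hM
  have hn : 1 ≤ n := by
    rcases Nat.eq_zero_or_pos n with rfl | h
    · exact absurd (Subsingleton.elim a 0) ha
    · exact h
  set L := Nat.log 2 (normOne a) + 2 with hL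
  have hb := time_bound n hn ε hε α a L hL
  have hLb := L_bound ε hε (normOne a) hM L hL
  set M := normOne a
  have hM0 : (0:ℝ) < M := by
    have : (81:ℝ) ≤ M := by exact_mod_cast hM
    linarith
  have hn0 : (0:ℝ) < n := by exact_mod_cast hn
  have hL0 : (1:ℝ) < L := by rw [hL]; push_cast; linarith [(by positivity : (0:ℝ) ≤ (Nat.log 2 M : ℝ))]
  have hlL : 0 < Real.log L := Real.log_pos hL0
  have hA : 0 < (L:ℝ) * Real.log L ^ (1 + ε) := by
    have := Real.rpow_pos_of_pos hlL (1 + ε)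
    positivity
  set A := (L:ℝ) * Real.log L ^ (1 + ε) with hAdef
  have e1 : (1 / (n : ℝ≥0∞)) = ENNReal.ofReal (1 / n) := by
    rw [ENNReal.ofReal_div_of_pos hn0]; simp
  have e2 : cEps ε * L * Real.log L ^ (1 + ε) = cEps ε * A := by rw [hAdef]; ring
  rw [e1, e2, ← ENNReal.ofReal_mul (by positivity), ← ENNReal.ofReal_mul (by positivity),
    ← ENNReal.ofReal_mul (by positivity), ← ENNReal.ofReal_natCast M,
    show (2:ℝ≥0∞) = ENNReal.ofReal 2 by simp, ← ENNReal.ofReal_mul (by norm_num)] at hb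
  set κ := 1 / (n:ℝ) * (1 / (2 * (cEps ε * A))) * Real.exp (-1) * (M * α) with hκ
  have hκ0 : 0 < κ := by positivity
  rw [mul_comm, ← ENNReal.le_div_iff_mul_le (by left; simpa using hκ0) (by left; simp),
    ← ENNReal.ofReal_div_of_pos hκ0] at hb
  refine hb.trans (ENNReal.ofReal_le_ofReal ?_)
  have e3 : 2 * (M:ℝ) / κ = 4 * cEps ε * Real.exp 1 * n / α * A := by
    rw [hκ, Real.exp_neg]
    field_simp
    ring
  rw [e3]
  calc _ ≤ 4 * cEps ε * Real.exp 1 * n / α *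
        (4 * 2 ^ (1 + ε) * (Real.log M * Real.log (Real.log M) ^ (1 + ε))) := by
        gcongr
    _ = _ := by
        field_simp
        ring
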